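/- arXiv:0912.4095 — 3 statements merged into one kernel-verified Lean document; each statement's English description precedes it below -/
import Mathlib

section
/- Let V be a real inner product space, F : V → ℝ a linear map, and let χ, α ∈ V satisfy ⟪α, χ⟫ = 0, F(χ) = ‖χ‖², α ≠ 0 and F(α) < 0. Then there exists μ > 0 such that F(μ • α − χ) < −‖χ‖ · ‖μ • α − χ‖. (Namely, for μ = −F(α)/‖α‖² one has F(μ • α − χ) = −‖μ • α − χ‖² and ‖μ • α − χ‖ > ‖χ‖.) -/
open scoped RealInnerProductSpace

/-- If `⟪α, χ⟫ = 0`, `F χ = ‖χ‖²`, `α ≠ 0` and `F α < 0`, then some `μ > 0` satisfies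
`F (μ • α - χ) < -‖χ‖ · ‖μ • α - χ‖`. -/
theorem stmt2 {V : Type*} [NormedAddCommGroup V] [InnerProductSpace ℝ V]
    (F : V →ₗ[ℝ] ℝ) (χ α : V) (horth : ⟪α, χ⟫ = 0) (hχ : F χ = ‖χ‖ ^ 2)
    (hα : α ≠ 0) (hF : F α < 0) :
    ∃ μ : ℝ, 0 < μ ∧ F (μ • α - χ) < -‖χ‖ * ‖μ • α - χ‖ := by
  have hα' : 0 < ‖α‖ := norm_pos_iff.mpr hα
  have hμ : 0 < -F α / ‖α‖ ^ 2 := div_pos (neg_pos.mpr hF) (by positivity)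
  refine ⟨-F α / ‖α‖ ^ 2, hμ, ?_⟩
  set μ : ℝ := -F α / ‖α‖ ^ 2 with hμ_def
  have hFα : F α = -(μ * ‖α‖ ^ 2) := by
    rw [hμ_def]
    field_simp
  have hnorm : ‖μ • α - χ‖ ^ 2 = μ ^ 2 * ‖α‖ ^ 2 + ‖χ‖ ^ 2 := by
    rw [norm_sub_sq_real, real_inner_smul_left, horth, norm_smul, mul_pow, Real.norm_eq_abs,
      sq_abs]
    ring
  have hval : F (μ • α - χ) = -‖μ • α - χ‖ ^ 2 := by
    rw [hnorm, map_sub, map_smul, hχ, hFα, smul_eq_mul]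
    ring
  have hlt : ‖χ‖ < ‖μ • α - χ‖ := by
    refine lt_of_pow_lt_pow_left₀ 2 (norm_nonneg _) ?_
    rw [hnorm]
    exact lt_add_of_pos_left _ (by positivity)
  rw [hval, neg_mul, neg_lt_neg_iff, sq]
  exact mul_lt_mul_of_pos_right hlt ((norm_nonneg χ).trans_lt hlt)
end

section
/- Let V be a real inner product space, F : V → ℝ a linear map, and let χ, α ∈ V satisfy ⟪α, χ⟫ = 0 and F(χ) = ‖χ‖². If for every μ > 0 one has F(μ • α − χ) ≥ −‖χ‖ · ‖μ • α − χ‖, then F(α) ≥ 0. -/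
open scoped RealInnerProductSpace

/-- If `⟪α, χ⟫ = 0`, `F χ = ‖χ‖²`, and `F (μ • α - χ) ≥ -‖χ‖ · ‖μ • α - χ‖` for every
`μ > 0`, then `F α ≥ 0`. -/
theorem stmt3 {V : Type*} [NormedAddCommGroup V] [InnerProductSpace ℝ V]
    (F : V →ₗ[ℝ] ℝ) (χ α : V) (horth : ⟪α, χ⟫ = 0) (hχ : F χ = ‖χ‖ ^ 2)
    (h : ∀ μ : ℝ, 0 < μ → F (μ • α - χ) ≥ -‖χ‖ * ‖μ • α - χ‖) :
    F α ≥ 0 := by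
  have key : ∀ μ : ℝ, 0 < μ → -(μ * ‖α‖ ^ 2 / 2) ≤ F α := by
    intro μ hμ
    have hF := h μ hμ
    rw [map_sub, map_smul, smul_eq_mul, hχ] at hF
    have hnorm : ‖μ • α - χ‖ ^ 2 = μ ^ 2 * ‖α‖ ^ 2 + ‖χ‖ ^ 2 := by
      rw [norm_sub_sq_real, real_inner_smul_left, horth, norm_smul, mul_pow, Real.norm_eq_abs,
        sq_abs]
      ring
    refine le_of_mul_le_mul_left ?_ hμ
    nlinarith [sq_nonneg (‖χ‖ - ‖μ • α - χ‖)]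
  by_contra! hneg
  have hpos : 0 < ‖α‖ ^ 2 + 1 := by positivity
  have hle := key (-F α / (‖α‖ ^ 2 + 1)) (div_pos (neg_pos.mpr hneg) hpos)
  have hcancel : -F α / (‖α‖ ^ 2 + 1) * (‖α‖ ^ 2 + 1) = -F α := div_mul_cancel₀ _ hpos.ne'
  have hquot : 0 < -F α / (‖α‖ ^ 2 + 1) := div_pos (neg_pos.mpr hneg) hpos
  linarith
end

section
/- Let n ≥ 2 be a natural number, let a₀, a₁, b₀, b₁, λ be real numbers with a₀ > 0, and let â₀, â₁, b̂₀, b̂₁ : ℝ → ℝ be functions such that, as ε → 0⁺: â₀(ε) − a₀ = O(εⁿ), b̂₀(ε) − b₀ = O(εⁿ), â₁(ε) = a₁ − ε^{n−1}/(2·(n−2)!), and b̂₁(ε) = b₁ − λ·ε^{n−1}/(2·(n−2)!). Then, as ε → 0⁺, (â₁(ε)/â₀(ε))·b̂₀(ε) − b̂₁(ε) = ((a₁/a₀)·b₀ − b₁) + (λ − b₀/a₀)·ε^{n−1}/(2·(n−2)!) + O(εⁿ). -/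
open Filter Asymptotics Topology

/-- If `f - a` and `g - b` are both `O(h)` with `h → 0` and `b ≠ 0`, then so is `f / g - a / b`. -/
theorem isBigO_div_sub_div {α : Type*} {l : Filter α} {f g h : α → ℝ} {a b : ℝ} (hb : b ≠ 0)
    (hh : Tendsto h l (𝓝 0)) (hf : (fun x => f x - a) =O[l] h)
    (hg : (fun x => g x - b) =O[l] h) :
    (fun x => f x / g x - a / b) =O[l] h := by
  have hlim : Tendsto g l (𝓝 b) := by
    simpa using (hg.trans_tendsto hh).add_const b
  have hinv : (fun x => (g x)⁻¹) =O[l] fun _ => (1 : ℝ) := (hlim.inv₀ hb).isBigO_one ℝ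
  have key := hinv.mul (hf.sub (hg.const_mul_left (a / b)))
  refine key.congr' ?_ (Eventually.of_forall fun x => one_mul _)
  filter_upwards [hlim.eventually_ne hb] with x hx
  field_simp
  ring

/-- Expansion of the Donaldson–Futaki invariant of the blown-up test-configuration:
if `â₀ = a₀ + O(εⁿ)`, `b̂₀ = b₀ + O(εⁿ)`, `â₁ = a₁ - ε^(n-1)/(2(n-2)!)` and
`b̂₁ = b₁ - λ ε^(n-1)/(2(n-2)!)` as `ε → 0⁺`, then
`(â₁/â₀)·b̂₀ - b̂₁ = (a₁/a₀)·b₀ - b₁ + (λ - b₀/a₀)·ε^(n-1)/(2(n-2)!) + O(εⁿ)`. -/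
theorem stmt5 (n : ℕ) (hn : 2 ≤ n) (a₀ a₁ b₀ b₁ lam : ℝ) (ha₀ : 0 < a₀)
    (ahat₀ ahat₁ bhat₀ bhat₁ : ℝ → ℝ)
    (h0 : (fun ε => ahat₀ ε - a₀) =O[𝓝[>] (0 : ℝ)] fun ε => ε ^ n)
    (h0' : (fun ε => bhat₀ ε - b₀) =O[𝓝[>] (0 : ℝ)] fun ε => ε ^ n)
    (h1 : ∀ᶠ ε in 𝓝[>] (0 : ℝ),
      ahat₁ ε = a₁ - ε ^ (n - 1) / (2 * (Nat.factorial (n - 2) : ℝ)))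
    (h1' : ∀ᶠ ε in 𝓝[>] (0 : ℝ),
      bhat₁ ε = b₁ - lam * ε ^ (n - 1) / (2 * (Nat.factorial (n - 2) : ℝ))) :
    (fun ε => (ahat₁ ε / ahat₀ ε) * bhat₀ ε - bhat₁ ε -
        ((a₁ / a₀) * b₀ - b₁ +
          (lam - b₀ / a₀) * ε ^ (n - 1) / (2 * (Nat.factorial (n - 2) : ℝ))))
      =O[𝓝[>] (0 : ℝ)] fun ε => ε ^ n := by
  have hpow {m : ℕ} (hm : m ≠ 0) : Tendsto (fun ε : ℝ => ε ^ m) (𝓝[>] 0) (𝓝 0) := by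
    have h : Tendsto (fun ε : ℝ => ε ^ m) (𝓝 0) (𝓝 (0 ^ m)) := (continuous_pow m).tendsto 0
    rw [zero_pow hm] at h
    exact h.mono_left nhdsWithin_le_nhds
  have hquot := isBigO_div_sub_div ha₀.ne' (hpow (by omega)) h0' h0
  have hbdd : (fun ε : ℝ => a₁ - ε ^ (n - 1) / (2 * (Nat.factorial (n - 2) : ℝ)))
      =O[𝓝[>] (0 : ℝ)] fun _ => (1 : ℝ) :=
    (((hpow (by omega)).div_const _).const_sub a₁).isBigO_one ℝ
  refine (hbdd.mul hquot).congr' ?_ (Eventually.of_forall fun ε => one_mul _)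
  filter_upwards [h1, h1'] with ε hε hε'
  rw [hε, hε']
  ring
end
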